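/- arXiv:2602.01473 — 8 statements merged into one kernel-verified Lean document; each statement's English description precedes it below -/
import Mathlib

section
/- Let N ≥ 4 be an integer and let n₁, n₂, n₃ be integers, each coprime to N, satisfying n₁ + n₂ + n₃ ≡ 0 (mod N). Then for every τ in the upper half-plane, G¹_{n₁}(τ)·G¹_{n₂}(τ) + G¹_{n₂}(τ)·G¹_{n₃}(τ) + G¹_{n₃}(τ)·G¹_{n₁}(τ) = G²_{n₁}(τ) + G²_{n₂}(τ) + G²_{n₃}(τ). -/
open Complex

/-- `q = e^{2πiτ}`. -/
noncomputable def qexp (τ : ℂ) : ℂ := Complex.exp (2 * Real.pi * Complex.I * τ)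

/-- The weight one level `N` Eisenstein series `G¹_r`, given by its `q`-expansion
`G¹_r(τ) = (1/2 − {r/N}) + Σ_{m ≥ 1} Σ_{n ≥ 1, n ≡ r mod N} q^{mn}
          − Σ_{m ≥ 1} Σ_{n ≥ 1, n ≡ −r mod N} q^{mn}`. -/
noncomputable def G1 (N : ℕ) (r : ℤ) (τ : ℂ) : ℂ :=
  ((1 / 2 - Int.fract ((r : ℝ) / N) : ℝ) : ℂ)
    + ∑' (m : ℕ) (n : ℕ),
        (if ((n : ℤ) + 1) ≡ r [ZMOD N] then qexp τ ^ ((m + 1) * (n + 1)) else 0)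
    - ∑' (m : ℕ) (n : ℕ),
        (if ((n : ℤ) + 1) ≡ -r [ZMOD N] then qexp τ ^ ((m + 1) * (n + 1)) else 0)

/-- The weight two level `N` Eisenstein series `G²_r`, given by its `q`-expansion
`G²_r(τ) = −(1/2)({r/N}² − {r/N} + 1/6)
          + (1/N)(Σ_{m ≥ 1} Σ_{n ≥ 1, n ≡ r mod N} n·q^{mn}
                  + Σ_{m ≥ 1} Σ_{n ≥ 1, n ≡ −r mod N} n·q^{mn})`. -/
noncomputable def G2 (N : ℕ) (r : ℤ) (τ : ℂ) : ℂ :=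
  ((-(1 / 2) * (Int.fract ((r : ℝ) / N) ^ 2 - Int.fract ((r : ℝ) / N) + 1 / 6) : ℝ) : ℂ)
    + (1 / (N : ℂ)) *
      ((∑' (m : ℕ) (n : ℕ),
          (if ((n : ℤ) + 1) ≡ r [ZMOD N] then ((n : ℂ) + 1) * qexp τ ^ ((m + 1) * (n + 1)) else 0))
        + ∑' (m : ℕ) (n : ℕ),
          (if ((n : ℤ) + 1) ≡ -r [ZMOD N] then ((n : ℂ) + 1) * qexp τ ^ ((m + 1) * (n + 1)) else 0))

noncomputable def bgP (q : ℂ) (n : ℤ) : ℂ := q ^ n / (1 - q ^ n)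

noncomputable def bgE (q : ℂ) (N a k : ℤ) : ℂ :=
  if 0 ≤ k then bgP q (a + k * N) else -bgP q (-(a + k * N))

lemma bg_congr {ι : Type} {f g : ι → ℂ} {a : ℂ} (h : HasSum f a) (e : ∀ i, g i = f i) :
    HasSum g a := by
  rwa [funext e]

lemma bg_ne (q : ℂ) (hq : ‖q‖ < 1) (n : ℤ) (hn : 0 < n) : 1 - q ^ n ≠ 0 := by
  lift n to ℕ using hn.le
  intro h
  have h1 : q ^ n = 1 := by
    rw [zpow_natCast] at h
    linear_combination -h
  have h2 : ‖q‖ ^ n = 1 := by rw [← norm_pow, h1, norm_one]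
  have : ‖q‖ ^ n < 1 := pow_lt_one₀ (norm_nonneg _) hq (by omega)
  linarith

lemma bgP_id (q : ℂ) (h0 : q ≠ 0) (hq : ‖q‖ < 1) (l m s : ℤ) (hl : 0 < l) (hm : 0 < m)
    (hs : s = l + m) :
    bgP q l * bgP q m - bgP q s * (bgP q l + bgP q m) = bgP q s := by
  subst hs
  have h1 := bg_ne q hq l hl
  have h2 := bg_ne q hq m hm
  have h3 := bg_ne q hq (l + m) (by omega)
  unfold bgP
  rw [zpow_add₀ h0] at *
  field_simp
  ring

lemma bgE_pos (q : ℂ) (N a k : ℤ) (h : 0 ≤ k) : bgE q N a k = bgP q (a + k * N) := by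
  simp [bgE, h]
lemma bgE_neg (q : ℂ) (N a k : ℤ) (h : k < 0) : bgE q N a k = -bgP q (-(a + k * N)) := by
  simp [bgE, h]

noncomputable def bgD (E : ℤ → ℂ) (k i : ℤ) : ℂ :=
  if 0 ≤ i ∧ 0 ≤ -1 - k - i then -E k else if i < 0 ∧ -1 - k - i < 0 then E k else 0

lemma bg_T (q : ℂ) (h0 : q ≠ 0) (hq : ‖q‖ < 1) (N a b c : ℤ) (ha : 0 < a) (hb : 0 < b)
    (hc : 0 < c) (hs : a + b + c = N) (i j : ℤ) :
    bgE q N a i * bgE q N b j + bgE q N b j * bgE q N c (-1 - i - j)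
      + bgE q N c (-1 - i - j) * bgE q N a i
    = bgD (bgE q N c) (-1 - i - j) i + bgD (bgE q N a) i j + bgD (bgE q N b) j i := by
  obtain ⟨k, hk⟩ : ∃ k, k = -1 - i - j := ⟨_, rfl⟩
  have pos : ∀ x y : ℤ, 0 < x → 0 ≤ y → 0 < x + y * N := fun x y hx hy => by
    have : 0 ≤ y * N := mul_nonneg hy (by omega)
    omega
  have neg : ∀ x y : ℤ, x < N → y < 0 → 0 < -(x + y * N) := fun x y hx hy => by
    have : 0 ≤ (-1 - y) * N := mul_nonneg (by omega) (by omega)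
    linarith
  have e1 : -1 - k - i = j := by omega
  have e2 : -1 - j - i = k := by omega
  have hsum : (a + i * N) + (b + j * N) + (c + k * N) = 0 := by
    rw [hk, ← hs]; ring
  simp only [bgD, ← hk, e1, e2]
  rcases le_or_gt 0 i with hi | hi <;> rcases le_or_gt 0 j with hj | hj <;>
    rcases le_or_gt 0 k with hk' | hk' <;> try omega
  · have := bgP_id q h0 hq _ _ (-(c + k * N)) (pos a i ha hi) (pos b j hb hj) (by omega)
    simp only [bgE_pos q N a i hi, bgE_pos q N b j hj, bgE_neg q N c k hk', hi, hj, hk',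
      hi.not_gt, hj.not_gt, hk'.not_ge, and_true, and_false, if_true, if_false, false_and, and_self]
    linear_combination this
  · have := bgP_id q h0 hq _ _ (-(b + j * N)) (pos a i ha hi) (pos c k hc hk') (by omega)
    simp only [bgE_pos q N a i hi, bgE_neg q N b j hj, bgE_pos q N c k hk', hi, hj, hk',
      hi.not_gt, hj.not_ge, hk'.not_gt, and_true, and_false, if_true, if_false, false_and, and_self]
    linear_combination this
  · have := bgP_id q h0 hq _ _ (a + i * N) (neg b j (by omega) hj) (neg c k (by omega) hk') (by omega)
    simp only [bgE_pos q N a i hi, bgE_neg q N b j hj, bgE_neg q N c k hk', hi, hj, hk',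
      hi.not_gt, hj.not_ge, hk'.not_ge, and_true, and_false, if_true, if_false, false_and, and_self]
    linear_combination this
  · have := bgP_id q h0 hq _ _ (-(a + i * N)) (pos b j hb hj) (pos c k hc hk') (by omega)
    simp only [bgE_neg q N a i hi, bgE_pos q N b j hj, bgE_pos q N c k hk', hi, hj, hk',
      hi.not_ge, hj.not_gt, hk'.not_gt, and_true, and_false, if_true, if_false, false_and, and_self]
    linear_combination this
  · have := bgP_id q h0 hq _ _ (b + j * N) (neg a i (by omega) hi) (neg c k (by omega) hk') (by omega)
    simp only [bgE_neg q N a i hi, bgE_pos q N b j hj, bgE_neg q N c k hk', hi, hj, hk',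
      hi.not_ge, hj.not_gt, hk'.not_ge, and_true, and_false, if_true, if_false, false_and, and_self]
    linear_combination this
  · have := bgP_id q h0 hq _ _ (c + k * N) (neg a i (by omega) hi) (neg b j (by omega) hj) (by omega)
    simp only [bgE_neg q N a i hi, bgE_neg q N b j hj, bgE_pos q N c k hk', hi, hj, hk',
      hi.not_ge, hj.not_ge, hk'.not_gt, and_true, and_false, if_true, if_false, false_and, and_self]
    linear_combination this

lemma bgD_inner (E : ℤ → ℂ) (k : ℤ) : HasSum (fun i => bgD E k i) (k * E k) := by
  rcases le_or_gt 0 k with hk | hk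
  · have : (k : ℂ) * E k = ∑ i ∈ Finset.Ico (-k) 0, bgD E k i := by
      rw [Finset.sum_congr rfl (g := fun _ => E k)]
      · simp
        left
        exact_mod_cast (Int.toNat_of_nonneg hk).symm
      · intro i hi
        rw [Finset.mem_Ico] at hi
        rw [bgD, if_neg (by omega), if_pos (by omega)]
    rw [this]
    apply hasSum_sum_of_ne_finset_zero
    intro i hi
    rw [Finset.mem_Ico] at hi
    rw [bgD, if_neg (by omega), if_neg (by omega)]
  · have : (k : ℂ) * E k = ∑ i ∈ Finset.Ico 0 (-k), bgD E k i := by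
      rw [Finset.sum_congr rfl (g := fun _ => -E k)]
      · have h : (((-k).toNat : ℤ) : ℂ) = ((-k : ℤ) : ℂ) := by
          rw [Int.toNat_of_nonneg (by omega)]
        push_cast at h
        simp [h]
      · intro i hi
        rw [Finset.mem_Ico] at hi
        rw [bgD, if_pos (by omega)]
    rw [this]
    apply hasSum_sum_of_ne_finset_zero
    intro i hi
    rw [Finset.mem_Ico] at hi
    rw [bgD, if_neg (by omega), if_neg (by omega)]

lemma bgD_norm (E : ℤ → ℂ) (k i : ℤ) :
    (‖bgD E k i‖ : ℝ) = ‖bgD (fun k => (k.sign : ℂ) * ‖E k‖) k i‖ ∧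
    ((‖bgD E k i‖ : ℝ) : ℂ) = bgD (fun k => (k.sign : ℂ) * ‖E k‖) k i := by
  unfold bgD
  split_ifs with h1 h2
  · have : k.sign = -1 := Int.sign_eq_neg_one_of_neg (by omega)
    simp [this]
  · have : k.sign = 1 ∨ k = 0 := by
      rcases lt_trichotomy k 0 with h | h | h
      · omega
      · exact Or.inr h
      · exact Or.inl (Int.sign_eq_one_of_pos h)
    rcases this with h | h
    · simp [h]
    · omega
  · simp

lemma bgD_sum (E : ℤ → ℂ) (hE : Summable fun k : ℤ => (k : ℂ) * E k) :
    HasSum (fun p : ℤ × ℤ => bgD E p.1 p.2) (∑' k : ℤ, (k : ℂ) * E k) := by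
  have hin : ∀ k, HasSum (fun i => ‖bgD E k i‖) ‖(k : ℂ) * E k‖ := by
    intro k
    have h := bgD_inner (fun k => (k.sign : ℂ) * ‖E k‖) k
    simp only [← (bgD_norm E k _).2] at h
    rw [← Complex.hasSum_ofReal]
    convert h using 1
    rw [norm_mul, Complex.norm_intCast]
    have : ((|(k:ℝ)| : ℝ) : ℂ) = k * k.sign := by
      have : |k| = k * k.sign := by rw [mul_comm, Int.sign_mul_self_eq_abs]
      exact_mod_cast congrArg (Int.cast : ℤ → ℂ) this
    rw [Complex.ofReal_mul, this, mul_assoc]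
  have hs : Summable (fun p : ℤ × ℤ => bgD E p.1 p.2) := by
    apply Summable.of_norm
    rw [summable_prod_of_nonneg (fun _ => norm_nonneg _)]
    refine ⟨fun k => (hin k).summable, ?_⟩
    simp only [(hin _).tsum_eq]
    exact hE.norm
  have := hs.hasSum
  rwa [hs.tsum_prod' (fun k => (bgD_inner E k).summable), tsum_congr (fun k => (bgD_inner E k).tsum_eq)] at this

def bgEq1 : ℤ × ℤ ≃ ℤ × ℤ where
  toFun p := (-1 - p.1 - p.2, p.1)
  invFun p := (p.2, -1 - p.1 - p.2)
  left_inv p := by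
    ext
    · rfl
    · simp only; ring
  right_inv p := by
    ext
    · simp only; ring
    · rfl

lemma bg_core (q : ℂ) (h0 : q ≠ 0) (hq : ‖q‖ < 1) (N a b c : ℤ) (ha : 0 < a) (hb : 0 < b)
    (hc : 0 < c) (hs : a + b + c = N)
    (s : ∀ x : ℤ, 0 < x → x < N → Summable (bgE q N x))
    (t : ∀ x : ℤ, 0 < x → x < N → Summable (fun k : ℤ => (k : ℂ) * bgE q N x k)) :
    (∑' k, bgE q N a k) * (∑' k, bgE q N b k) + (∑' k, bgE q N b k) * (∑' k, bgE q N c k)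
      + (∑' k, bgE q N c k) * (∑' k, bgE q N a k)
    = ∑' k : ℤ, (k : ℂ) * bgE q N a k + ∑' k : ℤ, (k : ℂ) * bgE q N b k
      + ∑' k : ℤ, (k : ℂ) * bgE q N c k := by
  have key : ∀ x y : ℤ, 0 < x → x < N → 0 < y → y < N →
      HasSum (fun p : ℤ × ℤ => bgE q N x p.1 * bgE q N y p.2)
        ((∑' k, bgE q N x k) * (∑' k, bgE q N y k)) := fun x y hx hx' hy hy' =>
    (s x hx hx').hasSum.mul (s y hy hy').hasSum
      (summable_mul_of_summable_norm (s x hx hx').norm (s y hy hy').norm)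
  have k1 := key a b ha (by omega) hb (by omega)
  have k3 := bgEq1.hasSum_iff.mpr (key c a hc (by omega) ha (by omega))
  have k2 := (bgEq1.trans bgEq1).hasSum_iff.mpr (key b c hb (by omega) hc (by omega))
  have d3 := bgEq1.hasSum_iff.mpr (bgD_sum _ (t c hc (by omega)))
  have d1 := bgD_sum _ (t a ha (by omega))
  have d2 := (Equiv.prodComm ℤ ℤ).hasSum_iff.mpr (bgD_sum _ (t b hb (by omega)))
  have L := (k1.add k2).add k3
  have R := (d1.add d2).add d3
  have hf := funext (fun p : ℤ × ℤ => bg_T q h0 hq N a b c ha hb hc hs p.1 p.2)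
  have e2 : ∀ i j : ℤ, -1 - (-1 - i - j) - i = j := fun i j => by ring
  have L' := bg_congr (g := fun p : ℤ × ℤ => bgE q N a p.1 * bgE q N b p.2
      + bgE q N b p.2 * bgE q N c (-1 - p.1 - p.2)
      + bgE q N c (-1 - p.1 - p.2) * bgE q N a p.1) L (fun p => by
        simp [bgEq1, e2])
  rw [hf] at L'
  have R' := bg_congr (g := fun p : ℤ × ℤ => bgD (bgE q N c) (-1 - p.1 - p.2) p.1
      + bgD (bgE q N a) p.1 p.2 + bgD (bgE q N b) p.2 p.1) R (fun p => by
        simp [bgEq1]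
        ring)
  exact L'.unique R'

lemma bgP_bound (q : ℂ) (hq : ‖q‖ < 1) (n : ℕ) :
    ‖bgP q n‖ ≤ (1 - ‖q‖)⁻¹ * ‖q‖ ^ n := by
  rcases Nat.eq_zero_or_pos n with rfl | hn
  · simp [bgP, hq.le]
  · unfold bgP
    rw [zpow_natCast, norm_div, norm_pow, div_eq_inv_mul]
    have : 1 - ‖q‖ ≤ ‖1 - q ^ n‖ := by
      have h1 := norm_sub_norm_le 1 (q ^ n)
      rw [norm_one, norm_pow] at h1
      have h2 : ‖q‖ ^ n ≤ ‖q‖ := pow_le_of_le_one (norm_nonneg _) hq.le (by omega)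
      linarith
    have h3 : 0 < 1 - ‖q‖ := by linarith
    gcongr

lemma bgP_s0 (q : ℂ) (hq : ‖q‖ < 1) : Summable fun n : ℕ => bgP q n :=
  Summable.of_norm_bounded ((summable_geometric_of_lt_one (norm_nonneg q) hq).mul_left _)
    (bgP_bound q hq)

lemma bgP_s1 (q : ℂ) (hq : ‖q‖ < 1) : Summable fun n : ℕ => (n : ℂ) * bgP q n := by
  have h := summable_pow_mul_geometric_of_norm_lt_one (R := ℝ) 1 (r := ‖q‖) (by simpa using hq)
  refine Summable.of_norm_bounded (h.mul_left (1 - ‖q‖)⁻¹) fun n => ?_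
  rw [norm_mul, Complex.norm_natCast]
  calc (n : ℝ) * ‖bgP q n‖ ≤ n * ((1 - ‖q‖)⁻¹ * ‖q‖ ^ n) := by
        gcongr; exact bgP_bound q hq n
    _ = _ := by ring

lemma bg_inj (N a : ℕ) (hN : 0 < N) : Function.Injective (fun k : ℕ => a + k * N) := by
  intro x y h
  simpa [hN.ne'] using h

set_option maxHeartbeats 2000000 in
lemma bg_tsum (q : ℂ) (hq : ‖q‖ < 1) (N a : ℕ) (ha : 0 < a) (haN : a < N) (r : ℤ)
    (hr : r ≡ a [ZMOD N]) (w : ℕ → ℂ) (hw : ∀ n, ‖w n‖ ≤ n + 1) :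
    ∑' (m : ℕ) (n : ℕ), (if ((n : ℤ) + 1) ≡ r [ZMOD N] then w n * q ^ ((m + 1) * (n + 1)) else 0)
      = ∑' k : ℕ, w (a - 1 + k * N) * bgP q ((a + k * N : ℕ) : ℤ) := by
  have hs : Summable (fun p : ℕ × ℕ => (if ((p.2 : ℤ) + 1) ≡ r [ZMOD N] then
      w p.2 * q ^ ((p.1 + 1) * (p.2 + 1)) else 0)) := by
    have g := summable_geometric_of_lt_one (norm_nonneg q) hq
    have h := (summable_pow_mul_geometric_of_norm_lt_one (R := ℝ) 1 (r := ‖q‖)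
      (by simpa using hq)).add g
    refine Summable.of_norm_bounded (g.mul_of_nonneg h (fun _ => by positivity)
      (fun _ => by positivity)) fun p => ?_
    have e : ‖q‖ ^ ((p.1 + 1) * (p.2 + 1)) ≤ ‖q‖ ^ (p.1 + p.2) :=
      pow_le_pow_of_le_one (norm_nonneg _) hq.le (by nlinarith)
    split_ifs
    · rw [norm_mul, norm_pow]
      calc _ ≤ ((p.2 : ℝ) + 1) * ‖q‖ ^ (p.1 + p.2) := by
            gcongr; exact hw _
        _ = _ := by rw [pow_add]; ring
    · rw [norm_zero]; positivity
  have hsw := Summable.tsum_comm (f := fun m n : ℕ => (if ((n : ℤ) + 1) ≡ r [ZMOD N] then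
      w n * q ^ ((m + 1) * (n + 1)) else 0)) hs
  rw [← hsw]
  have inner : ∀ n : ℕ, ∑' m : ℕ, (if ((n : ℤ) + 1) ≡ r [ZMOD N] then
      w n * q ^ ((m + 1) * (n + 1)) else 0) =
      if ((n : ℤ) + 1) ≡ r [ZMOD N] then w n * bgP q ((n + 1 : ℕ) : ℤ) else 0 := by
    intro n
    split_ifs
    · rw [tsum_mul_left]
      congr 1
      have : ∀ m : ℕ, q ^ ((m + 1) * (n + 1)) = q ^ (n + 1) * (q ^ (n + 1)) ^ m := by
        intro m; rw [← pow_mul, ← pow_add]; congr 1; ring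
      simp only [this]
      rw [tsum_mul_left, tsum_geometric_of_norm_lt_one, bgP, zpow_natCast, div_eq_mul_inv]
      rw [norm_pow]
      exact pow_lt_one₀ (norm_nonneg _) hq (by omega)
    · simp
  rw [tsum_congr inner]
  have hinj := bg_inj N (a - 1) (by omega)
  rw [← hinj.tsum_eq]
  · apply tsum_congr
    intro k
    rw [if_pos]
    · rw [show a - 1 + k * N + 1 = a + k * N by omega]
    · have : (((a - 1 + k * N : ℕ) : ℤ) + 1) = a + k * N := by
        push_cast [Nat.cast_sub (show 1 ≤ a by omega)]; ring
      rw [this]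
      refine Int.ModEq.trans ?_ hr.symm
      simp [Int.ModEq]
  · intro n hn
    have hc : ((n : ℤ) + 1) ≡ r [ZMOD N] := by
      by_contra h
      simp [h] at hn
    have h1 := hc.trans hr
    have h2 : n + 1 ≡ a [MOD N] := by
      rw [← Int.natCast_modEq_iff]; exact_mod_cast h1
    have h3 : (n + 1) % N = a := by
      rw [h2, Nat.mod_eq_of_lt haN]
    refine ⟨(n + 1) / N, ?_⟩
    have := Nat.mod_add_div (n + 1) N
    simp only
    rw [h3, mul_comm] at this
    omega

lemma bg_has (q : ℂ) (hq : ‖q‖ < 1) (N a : ℕ) (ha : 0 < a) (haN : a < N) :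
    HasSum (bgE q N a) (∑' k : ℕ, bgP q ((a + k * N : ℕ) : ℤ)
      - ∑' k : ℕ, bgP q ((N - a + k * N : ℕ) : ℤ)) ∧
    HasSum (fun k : ℤ => ((a + k * N : ℤ) : ℂ) * bgE q N a k)
      (∑' k : ℕ, ((a + k * N : ℕ) : ℂ) * bgP q ((a + k * N : ℕ) : ℤ)
      + ∑' k : ℕ, ((N - a + k * N : ℕ) : ℂ) * bgP q ((N - a + k * N : ℕ) : ℤ)) := by
  have hN : 0 < N := by omega
  have e : ∀ n : ℕ, -((a : ℤ) + -((n : ℤ) + 1) * N) = ((N - a + n * N : ℕ) : ℤ) := by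
    intro n
    push_cast [Nat.cast_sub haN.le]; ring
  have c1 : ∀ n : ℕ, bgE q N a n = bgP q ((a + n * N : ℕ) : ℤ) := by
    intro n
    rw [bgE_pos _ _ _ _ (by omega)]; push_cast; rfl
  have c2 : ∀ n : ℕ, bgE q N a (-((n : ℤ) + 1)) = -bgP q ((N - a + n * N : ℕ) : ℤ) := by
    intro n
    rw [bgE_neg _ _ _ _ (by omega), e]
  constructor
  · rw [sub_eq_add_neg]
    apply HasSum.of_nat_of_neg_add_one
    · simp only [c1]
      exact ((bgP_s0 q hq).comp_injective (bg_inj N a hN)).hasSum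
    · simp only [c2]
      exact ((bgP_s0 q hq).comp_injective (bg_inj N (N - a) hN)).hasSum.neg
  · apply HasSum.of_nat_of_neg_add_one
    · simp only [c1]
      have := ((bgP_s1 q hq).comp_injective (bg_inj N a hN)).hasSum
      refine bg_congr this fun n => ?_
      simp
    · simp only [c2]
      have := ((bgP_s1 q hq).comp_injective (bg_inj N (N - a) hN)).hasSum
      refine bg_congr this fun n => ?_
      rw [← neg_neg ((a : ℤ) + -((n : ℤ) + 1) * N), e]
      simp
      ring

lemma bg_t (q : ℂ) (hq : ‖q‖ < 1) (N a : ℕ) (ha : 0 < a) (haN : a < N) :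
    HasSum (fun k : ℤ => (k : ℂ) * bgE q N a k)
      ((∑' k : ℤ, ((a + k * N : ℤ) : ℂ) * bgE q N a k - a * ∑' k : ℤ, bgE q N a k) / N) := by
  have h := bg_has q hq N a ha haN
  have := ((h.2.summable.hasSum.sub (h.1.summable.hasSum.mul_left (a : ℂ))).div_const (N : ℂ))
  refine bg_congr this fun k => ?_
  have : (N : ℂ) ≠ 0 := by norm_cast; omega
  push_cast
  field_simp
  ring

lemma bg_fract (N a : ℕ) (haN : a < N) (r : ℤ) (hr : r ≡ a [ZMOD N]) :
    Int.fract ((r : ℝ) / N) = a / N := by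
  have hN : (0 : ℝ) < N := by norm_cast; omega
  rw [Int.fract_eq_iff]
  refine ⟨by positivity, by rw [div_lt_one hN]; exact_mod_cast haN, ?_⟩
  obtain ⟨k, hk⟩ := hr.symm.dvd
  refine ⟨k, ?_⟩
  have : (r : ℝ) - a = N * k := by exact_mod_cast hk
  field_simp
  linarith

lemma bg_negmod (N a : ℕ) (haN : a < N) (r : ℤ) (hr : r ≡ a [ZMOD N]) :
    -r ≡ (N - a : ℕ) [ZMOD N] := by
  have := hr.neg
  refine this.trans ?_
  push_cast [Nat.cast_sub haN.le]
  simp [Int.ModEq, sub_eq_add_neg]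

lemma bg_G1 (τ : ℂ) (hq : ‖qexp τ‖ < 1) (N a : ℕ) (ha : 0 < a) (haN : a < N) (r : ℤ)
    (hr : r ≡ a [ZMOD N]) :
    G1 N r τ = 1 / 2 - a / N + ∑' k : ℤ, bgE (qexp τ) N a k := by
  have h1 := bg_tsum (qexp τ) hq N a ha haN r hr (fun _ => 1) (fun n => by simp)
  have h2 := bg_tsum (qexp τ) hq N (N - a) (by omega) (by omega) (-r) (bg_negmod N a haN r hr)
    (fun _ => 1) (fun n => by simp)
  simp only [one_mul] at h1 h2
  rw [G1, h1, h2, (bg_has _ hq N a ha haN).1.tsum_eq, bg_fract N a haN r hr]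
  push_cast
  ring

lemma bg_G2 (τ : ℂ) (hq : ‖qexp τ‖ < 1) (N a : ℕ) (ha : 0 < a) (haN : a < N) (r : ℤ)
    (hr : r ≡ a [ZMOD N]) :
    G2 N r τ = -(1 / 2) * ((a / N : ℂ) ^ 2 - a / N + 1 / 6) +
      ∑' k : ℤ, (k : ℂ) * bgE (qexp τ) N a k + a / N * ∑' k : ℤ, bgE (qexp τ) N a k := by
  have hb : ∀ n : ℕ, ‖(n : ℂ) + 1‖ ≤ n + 1 := fun n => by
    have : (n : ℂ) + 1 = ((n + 1 : ℕ) : ℂ) := by push_cast; rfl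
    rw [this, Complex.norm_natCast]; push_cast; rfl
  have h1 := bg_tsum (qexp τ) hq N a ha haN r hr (fun n => (n : ℂ) + 1) hb
  have h2 := bg_tsum (qexp τ) hq N (N - a) (by omega) (by omega) (-r) (bg_negmod N a haN r hr)
    (fun n => (n : ℂ) + 1) hb
  have e : ∀ b k : ℕ, 0 < b → (((b - 1 + k * N : ℕ) : ℂ) + 1) = ((b + k * N : ℕ) : ℂ) := by
    intro b k hb
    rw [← Nat.cast_succ]; congr 1; omega
  simp only [e _ _ ha, e _ _ (show 0 < N - a by omega)] at h1 h2
  rw [G2, h1, h2, ← (bg_has _ hq N a ha haN).2.tsum_eq, bg_fract N a haN r hr,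
    (bg_t _ hq N a ha haN).tsum_eq]
  have : (N : ℂ) ≠ 0 := by norm_cast; omega
  push_cast
  field_simp
  ring

lemma bg_main (τ : ℂ) (hq : ‖qexp τ‖ < 1) (N a b c : ℕ) (ha : 0 < a) (hb : 0 < b) (hc : 0 < c)
    (hs : a + b + c = N) (n₁ n₂ n₃ : ℤ) (h₁ : n₁ ≡ a [ZMOD N]) (h₂ : n₂ ≡ b [ZMOD N])
    (h₃ : n₃ ≡ c [ZMOD N]) :
    G1 N n₁ τ * G1 N n₂ τ + G1 N n₂ τ * G1 N n₃ τ + G1 N n₃ τ * G1 N n₁ τ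
      = G2 N n₁ τ + G2 N n₂ τ + G2 N n₃ τ := by
  have core := bg_core (qexp τ) (Complex.exp_ne_zero _) hq N a b c (by omega) (by omega) (by omega)
    (by omega)
    (fun x hx hx' => by
      lift x to ℕ using hx.le
      exact (bg_has _ hq N x (by omega) (by omega)).1.summable)
    (fun x hx hx' => by
      lift x to ℕ using hx.le
      exact (bg_t _ hq N x (by omega) (by omega)).summable)
  rw [bg_G1 τ hq N a ha (by omega) n₁ h₁, bg_G1 τ hq N b hb (by omega) n₂ h₂,
    bg_G1 τ hq N c hc (by omega) n₃ h₃, bg_G2 τ hq N a ha (by omega) n₁ h₁,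
    bg_G2 τ hq N b hb (by omega) n₂ h₂, bg_G2 τ hq N c hc (by omega) n₃ h₃]
  have hN : (N : ℂ) ≠ 0 := by norm_cast; omega
  have hx : (c : ℂ) / N = 1 - a / N - b / N := by
    field_simp
    rw [← hs]; push_cast; ring
  rw [hx]
  linear_combination core

lemma bg_G1_neg (τ : ℂ) (N a : ℕ) (ha : 0 < a) (haN : a < N) (r : ℤ)
    (hr : r ≡ a [ZMOD N]) : G1 N (-r) τ = -G1 N r τ := by
  have hN : (N : ℂ) ≠ 0 := by norm_cast; omega
  rw [G1, G1, bg_fract N a haN r hr, bg_fract N (N - a) (by omega) (-r) (bg_negmod N a haN r hr),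
    neg_neg]
  push_cast [Nat.cast_sub haN.le]
  field_simp
  ring

lemma bg_G2_neg (τ : ℂ) (N a : ℕ) (ha : 0 < a) (haN : a < N) (r : ℤ)
    (hr : r ≡ a [ZMOD N]) : G2 N (-r) τ = G2 N r τ := by
  have hN : (N : ℂ) ≠ 0 := by norm_cast; omega
  rw [G2, G2, bg_fract N a haN r hr, bg_fract N (N - a) (by omega) (-r) (bg_negmod N a haN r hr),
    neg_neg]
  push_cast [Nat.cast_sub haN.le]
  field_simp
  ring

lemma bg_res (N : ℕ) (hN : 4 ≤ N) (n : ℤ) (h : Int.gcd n N = 1) :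
    ∃ a : ℕ, 0 < a ∧ a < N ∧ n ≡ a [ZMOD N] := by
  have h0 := Int.emod_nonneg n (show (N : ℤ) ≠ 0 by omega)
  have h1 := Int.emod_lt_of_pos n (show (0 : ℤ) < N by omega)
  refine ⟨(n % N).toNat, ?_, by omega, ?_⟩
  · by_contra hc
    have : (N : ℤ) ∣ n := Int.dvd_of_emod_eq_zero (by omega)
    rw [Int.gcd_eq_right_iff_dvd (by omega) |>.mpr this |> Int.ofNat_inj.mp] at h
    omega
  · rw [Int.toNat_of_nonneg h0]
    exact (Int.mod_modEq n N).symm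

/-- **The Borisov–Gunnells relation.** Let `N ≥ 4` and let `n₁, n₂, n₃` be integers, each
coprime to `N`, with `n₁ + n₂ + n₃ ≡ 0 (mod N)`. Then for every `τ` in the upper half-plane,
`G¹_{n₁}G¹_{n₂} + G¹_{n₂}G¹_{n₃} + G¹_{n₃}G¹_{n₁} = G²_{n₁} + G²_{n₂} + G²_{n₃}`. -/
theorem borisov_gunnells_relation (N : ℕ) (hN : 4 ≤ N) (n₁ n₂ n₃ : ℤ)
    (h₁ : Int.gcd n₁ N = 1) (h₂ : Int.gcd n₂ N = 1) (h₃ : Int.gcd n₃ N = 1)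
    (hsum : n₁ + n₂ + n₃ ≡ 0 [ZMOD N])
    (τ : ℂ) (hτ : 0 < τ.im) :
    G1 N n₁ τ * G1 N n₂ τ + G1 N n₂ τ * G1 N n₃ τ + G1 N n₃ τ * G1 N n₁ τ
      = G2 N n₁ τ + G2 N n₂ τ + G2 N n₃ τ := by
  have hq : ‖qexp τ‖ < 1 := by
    rw [qexp, Complex.norm_exp, Real.exp_lt_one_iff]
    have : (2 * Real.pi * Complex.I * τ : ℂ).re = -(2 * Real.pi * τ.im) := by simp
    rw [this]
    have := Real.pi_pos
    have : 0 < 2 * Real.pi * τ.im := by positivity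
    linarith
  obtain ⟨a, ha, ha', ra⟩ := bg_res N hN n₁ h₁
  obtain ⟨b, hb, hb', rb⟩ := bg_res N hN n₂ h₂
  obtain ⟨c, hc, hc', rc⟩ := bg_res N hN n₃ h₃
  have hd : (N : ℤ) ∣ a + b + c :=
    Int.modEq_zero_iff_dvd.mp ((((ra.add rb).add rc).symm).trans hsum)
  obtain ⟨k, hk⟩ := hd
  have hk0 : 0 < k := by
    by_contra h
    have : (N : ℤ) * k ≤ 0 := mul_nonpos_of_nonneg_of_nonpos (by omega) (by omega)
    omega
  have hk3 : k < 3 := by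
    by_contra h
    have : (N : ℤ) * 3 ≤ N * k := mul_le_mul_of_nonneg_left (by omega) (by omega)
    omega
  have hk12 : k = 1 ∨ k = 2 := by omega
  rcases hk12 with rfl | rfl
  · exact bg_main τ hq N a b c ha hb hc (by omega) _ _ _ ra rb rc
  · have := bg_main τ hq N (N - a) (N - b) (N - c) (by omega) (by omega) (by omega) (by omega)
      (-n₁) (-n₂) (-n₃) (bg_negmod N a ha' _ ra) (bg_negmod N b hb' _ rb) (bg_negmod N c hc' _ rc)
    rw [bg_G1_neg τ N a ha ha' _ ra, bg_G1_neg τ N b hb hb' _ rb, bg_G1_neg τ N c hc hc' _ rc,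
      bg_G2_neg τ N a ha ha' _ ra, bg_G2_neg τ N b hb hb' _ rb, bg_G2_neg τ N c hc hc' _ rc] at this
    linear_combination this
end

section
/- Let N ≥ 1 be an integer and let n₁, n₂, n₃ be integers, each coprime to N, with n₁ + n₂ + n₃ ≡ 0 (mod N). Then there exist integers n′₁, n′₂, n′₃ with n′ᵢ ≡ nᵢ (mod N) for i = 1, 2, 3, such that n′₁ + n′₂ + n′₃ = 0 and gcd(n′₁, n′₂) = 1. -/
/-- Let `N ≥ 1` and let `n₁, n₂, n₃` be integers coprime to `N` with
`n₁ + n₂ + n₃ ≡ 0 (mod N)`. Then there are integers `n′₁, n′₂, n′₃`, congruent to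
`n₁, n₂, n₃` mod `N` respectively, with `n′₁ + n′₂ + n′₃ = 0` and `gcd(n′₁, n′₂) = 1`. -/
theorem exists_reduced_triple (N : ℕ) (hN : 1 ≤ N) (n₁ n₂ n₃ : ℤ)
    (h₁ : Int.gcd n₁ N = 1) (h₂ : Int.gcd n₂ N = 1) (h₃ : Int.gcd n₃ N = 1)
    (hsum : n₁ + n₂ + n₃ ≡ 0 [ZMOD N]) :
    ∃ n₁' n₂' n₃' : ℤ, n₁' ≡ n₁ [ZMOD N] ∧ n₂' ≡ n₂ [ZMOD N] ∧ n₃' ≡ n₃ [ZMOD N] ∧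
      n₁' + n₂' + n₃' = 0 ∧ Int.gcd n₁' n₂' = 1 := by
  obtain ⟨b, hb0, hb⟩ : ∃ b : ℤ, b ≠ 0 ∧ b ≡ n₂ [ZMOD N] := by
    by_cases h : n₂ = 0
    · refine ⟨N, by omega, ?_⟩
      subst h
      simp [Int.ModEq]
    · exact ⟨n₂, h, rfl⟩
  obtain ⟨p, hgt, hp, hmod⟩ := Nat.forall_exists_prime_gt_and_zmodEq b.natAbs
    (q := N) (a := n₁) (by omega) (Int.isCoprime_iff_gcd_eq_one.mpr h₁)
  refine ⟨p, b, -(p + b), hmod, hb, ?_, by ring, ?_⟩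
  · have h := (hmod.add hb).neg
    refine h.trans ?_
    have h' := hsum.symm.sub_right (n₁ + n₂)
    have e1 : 0 - (n₁ + n₂) = -(n₁ + n₂) := by ring
    have e2 : n₁ + n₂ + n₃ - (n₁ + n₂) = n₃ := by ring
    rwa [e1, e2] at h'
  · rw [Int.gcd_def, Int.natAbs_natCast]
    refine (Nat.Prime.coprime_iff_not_dvd hp).mpr fun hd => ?_
    have := Nat.le_of_dvd (by omega) hd
    omega
end

section
/- Let H_d denote the physicists' Hermite polynomials, defined by H₀(x) = 1, H₁(x) = 2x, and H_{d+1}(x) = 2x·H_d(x) − 2d·H_{d−1}(x). For all real numbers m, n and every natural number d, the Fourier-type integral identity ∫_ℝ H_d(√π·(m + a))·e^{−πm² − πa²}·e^{2πi·a·n} da = (2i√π)^d·(n − i·m)^d·e^{−πm² − πn²} holds. -/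
open MeasureTheory Real Complex

/-- The physicists' Hermite polynomials: `H₀(x) = 1`, `H₁(x) = 2x`,
`H_{d+1}(x) = 2x·H_d(x) − 2d·H_{d−1}(x)`. -/
noncomputable def hermiteP : ℕ → ℝ → ℝ
  | 0 => fun _ => 1
  | 1 => fun x => 2 * x
  | (d + 2) => fun x => 2 * x * hermiteP (d + 1) x - 2 * (d + 1) * hermiteP d x

theorem hermiteP_rec (d : ℕ) (x : ℝ) : hermiteP (d + 2) x
    = 2 * x * hermiteP (d + 1) x - 2 * (d + 1) * hermiteP d x := by
  simp only [hermiteP]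

theorem hermiteP_deriv_aux (d : ℕ) :
    (∀ x, HasDerivAt (hermiteP d) (2 * x * hermiteP d x - hermiteP (d + 1) x) x) ∧
    (∀ x, HasDerivAt (hermiteP (d + 1)) (2 * (d + 1) * hermiteP d x) x) := by
  induction d with
  | zero =>
    constructor
    · intro x
      have := hasDerivAt_const x (1 : ℝ)
      simpa [hermiteP] using this
    · intro x
      have := (hasDerivAt_id x).const_mul (2 : ℝ)
      simpa [hermiteP] using this
  | succ d ih =>
    obtain ⟨h1, h2⟩ := ih
    constructor
    · intro x
      convert! h2 x using 1
      rw [hermiteP_rec]; ring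
    · intro x
      have h := (((hasDerivAt_id x).const_mul (2 : ℝ)).mul (h2 x)).sub
        ((h1 x).const_mul (2 * ((d : ℝ) + 1)))
      have e : hermiteP (d + 1 + 1) = fun x => 2 * x * hermiteP (d + 1) x
          - 2 * (d + 1) * hermiteP d x := by
        funext x; exact hermiteP_rec d x
      rw [e]
      convert! h using 1
      push_cast
      simp only [id]
      ring

noncomputable def hfG (m n a : ℝ) : ℂ :=
  Complex.exp (-(π * m ^ 2) - π * a ^ 2) * Complex.exp (2 * π * Complex.I * a * n)

theorem hfG_int (m n : ℝ) (k : ℕ) : Integrable (fun a : ℝ => (a : ℂ) ^ k * hfG m n a) := by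
  have h := (integrable_rpow_mul_exp_neg_mul_sq pi_pos
    (s := (k : ℝ)) (by have := Nat.cast_nonneg (α := ℝ) k; linarith)).const_mul
      (Real.exp (-(π * m ^ 2)))
  refine h.norm.mono' ?_ ?_
  · apply Continuous.aestronglyMeasurable
    unfold hfG
    fun_prop
  · refine Filter.Eventually.of_forall fun a => le_of_eq ?_
    unfold hfG
    rw [Real.rpow_natCast, norm_mul, norm_mul, norm_mul, norm_mul, norm_pow, norm_pow,
      Complex.norm_exp, Complex.norm_exp, Real.norm_eq_abs (rexp _), Real.norm_eq_abs (rexp _),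
      Real.abs_exp, Real.abs_exp, Complex.norm_real]
    have e1 : (-(π * m ^ 2) - π * a ^ 2 : ℂ).re = -(π * m ^ 2) + -π * a ^ 2 := by
      rw [show (-(π * m ^ 2) - π * a ^ 2 : ℂ) = ((-(π * m ^ 2) + -π * a ^ 2 : ℝ) : ℂ) by
        push_cast; ring, Complex.ofReal_re]
    have e2 : (2 * π * Complex.I * a * n : ℂ).re = 0 := by
      rw [show (2 * π * Complex.I * a * n : ℂ) = ((2 * π * a * n : ℝ) : ℂ) * Complex.I by
        push_cast; ring]
      simp
    rw [e1, e2, Real.exp_add, Real.exp_zero]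
    ring

theorem hf_int (m n : ℝ) (d : ℕ) :
    (∀ k : ℕ, Integrable (fun a : ℝ =>
      (a : ℂ) ^ k * ((hermiteP d (Real.sqrt π * (m + a)) : ℂ) * hfG m n a))) ∧
    (∀ k : ℕ, Integrable (fun a : ℝ =>
      (a : ℂ) ^ k * ((hermiteP (d + 1) (Real.sqrt π * (m + a)) : ℂ) * hfG m n a))) := by
  induction d with
  | zero =>
    constructor
    · intro k
      simpa [hermiteP] using hfG_int m n k
    · intro k
      convert! ((hfG_int m n k).const_mul (2 * Real.sqrt π * m : ℂ)).add
        ((hfG_int m n (k + 1)).const_mul (2 * Real.sqrt π : ℂ)) using 1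
      funext a
      simp only [hermiteP, Pi.add_apply]
      push_cast
      ring
  | succ d ih =>
    refine ⟨ih.2, fun k => ?_⟩
    convert! (((ih.2 k).const_mul (2 * Real.sqrt π * m : ℂ)).add
        ((ih.2 (k + 1)).const_mul (2 * Real.sqrt π : ℂ))).sub
        ((ih.1 k).const_mul (2 * (d + 1) : ℂ)) using 1
    funext a
    simp only [Pi.add_apply, Pi.sub_apply]
    rw [hermiteP_rec]
    push_cast
    ring

theorem hf_int0 (m n : ℝ) (d : ℕ) : Integrable (fun a : ℝ =>
      (hermiteP d (Real.sqrt π * (m + a)) : ℂ) * hfG m n a) := by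
  simpa using (hf_int m n d).1 0

theorem hfG_deriv (m n a : ℝ) :
    HasDerivAt (hfG m n) ((-(2 * π * a) + 2 * π * Complex.I * n) * hfG m n a) a := by
  have h0 : HasDerivAt (fun a : ℝ => (a : ℂ)) 1 a := Complex.ofRealCLM.hasDerivAt
  have h1 := (((h0.pow 2).const_mul (π : ℂ)).const_sub (-(π * m ^ 2) : ℂ)).cexp
  have h2 := ((h0.const_mul (2 * π * Complex.I)).mul_const (n : ℂ)).cexp
  convert! h1.mul h2 using 1
  unfold hfG
  simp
  ring

theorem hf_deriv (m n : ℝ) (d : ℕ) (a : ℝ) :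
    HasDerivAt (fun a : ℝ => (hermiteP d (Real.sqrt π * (m + a)) : ℂ) * hfG m n a)
      ((2 * π * (m + Complex.I * n)) *
          ((hermiteP d (Real.sqrt π * (m + a)) : ℂ) * hfG m n a)
        - Real.sqrt π * ((hermiteP (d + 1) (Real.sqrt π * (m + a)) : ℂ) * hfG m n a)) a := by
  have h0 : HasDerivAt (fun a : ℝ => Real.sqrt π * (m + a)) (Real.sqrt π * 1) a :=
    ((hasDerivAt_id a).const_add m).const_mul _
  have h1 := (((hermiteP_deriv_aux d).1 (Real.sqrt π * (m + a))).comp a h0).ofReal_comp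
  convert! h1.mul (hfG_deriv m n a) using 1
  have hs : (Real.sqrt π : ℂ) ^ 2 = π := by
    rw [← Complex.ofReal_pow, Real.sq_sqrt pi_pos.le]
  simp only [Function.comp]
  push_cast
  linear_combination (-2 * (m + a) * (hermiteP d (Real.sqrt π * (m + a)) : ℂ) * hfG m n a) * hs

theorem hf_step (m n : ℝ) (d : ℕ) :
    (∫ a : ℝ, (hermiteP (d + 1) (Real.sqrt π * (m + a)) : ℂ) * hfG m n a)
      = 2 * Real.sqrt π * (m + Complex.I * n) *
        ∫ a : ℝ, (hermiteP d (Real.sqrt π * (m + a)) : ℂ) * hfG m n a := by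
  have i1 := (hf_int0 m n d).const_mul (2 * π * (m + Complex.I * n))
  have i2 := (hf_int0 m n (d + 1)).const_mul (Real.sqrt π : ℂ)
  have h := integral_eq_zero_of_hasDerivAt_of_integrable (hf_deriv m n d) (i1.sub i2)
    (hf_int0 m n d)
  rw [integral_sub i1 i2, integral_const_mul, integral_const_mul] at h
  have hs : (Real.sqrt π : ℂ) ^ 2 = π := by
    rw [← Complex.ofReal_pow, Real.sq_sqrt pi_pos.le]
  have hne : (Real.sqrt π : ℂ) ≠ 0 := by
    simpa using (Real.sqrt_pos.2 pi_pos).ne'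
  apply mul_left_cancel₀ hne
  rw [← hs] at h
  linear_combination -h

theorem hfG_integral (m n : ℝ) :
    (∫ a : ℝ, hfG m n a) = Complex.exp (-(π * m ^ 2) - π * n ^ 2) := by
  have h := integral_cexp_quadratic (b := -(π : ℂ)) (by simpa using pi_pos)
    (2 * π * Complex.I * n) (-(π * m ^ 2))
  have hp : (π : ℂ) ≠ 0 := by simpa using pi_pos.ne'
  have e : hfG m n = fun a : ℝ => Complex.exp (-(π : ℂ) * a ^ 2 + 2 * π * Complex.I * n * a
      + -(π * m ^ 2)) := by
    funext a
    unfold hfG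
    rw [← Complex.exp_add]
    congr 1
    ring
  rw [e, h, neg_neg, div_self hp, Complex.one_cpow, one_mul]
  congr 1
  field_simp
  linear_combination (4 * (n : ℂ) ^ 2) * Complex.I_sq

theorem hermite_fourier_integral (d : ℕ) (m n : ℝ) :
    (∫ a : ℝ, (hermiteP d (Real.sqrt π * (m + a)) : ℂ)
        * Complex.exp (-(π * m ^ 2) - π * a ^ 2)
        * Complex.exp (2 * π * Complex.I * a * n))
      = (2 * Complex.I * Real.sqrt π) ^ d * ((n : ℂ) - Complex.I * m) ^ d
        * Complex.exp (-(π * m ^ 2) - π * n ^ 2) := by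
  have key : (∫ a : ℝ, (hermiteP d (Real.sqrt π * (m + a)) : ℂ) * hfG m n a)
      = (2 * Complex.I * Real.sqrt π) ^ d * ((n : ℂ) - Complex.I * m) ^ d
        * Complex.exp (-(π * m ^ 2) - π * n ^ 2) := by
    induction d with
    | zero => simpa [hermiteP] using hfG_integral m n
    | succ d ih =>
      rw [hf_step, ih, ← mul_pow, ← mul_pow, pow_succ]
      have : (2 * Complex.I * Real.sqrt π) * ((n : ℂ) - Complex.I * m)
          = 2 * Real.sqrt π * (m + Complex.I * n) := by
        linear_combination (-2 * (Real.sqrt π : ℂ) * m) * Complex.I_sq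
      rw [this]
      ring
  rw [← key]
  simp only [hfG, mul_assoc]
end

section
/- For A = [[m₁, n₁],[m₂, n₂]] ∈ M₂(ℝ), define the partial Fourier transform φ̂(A) := ∫_{ℝ²} φ([[a, n₁],[m₂, b]])·e^{2πi(a·n₂ − b·m₁)} da db (the Fourier transform in the entries m₁ and n₂). Then for each (d₁, d₂) ∈ {(2,0), (0,2), (1,1)}: φ̂_{(d₁,d₂)}([[m₁, n₁],[m₂, n₂]]) = −(n₂ − i·n₁)^{d₁}·(−m₁ − i·m₂)^{d₂}·e^{−π(m₁² + m₂² + n₁² + n₂²)}. -/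
open MeasureTheory Real Complex

/-- The Schwartz function `φ_{(d₁,d₂)}` on `2×2` real matrices `[[m₁,n₁],[m₂,n₂]]`
(identified with the pair of columns `m = (m₁,m₂)`, `n = (n₁,n₂)`):
`φ_{(d₁,d₂)}(m,n) = (1/4π) e^{−π‖m‖² − π‖n‖²} H_{d₁}(√π(m₁+n₁)) H_{d₂}(√π(m₂+n₂))`. -/
noncomputable def phi (d₁ d₂ : ℕ) (m₁ m₂ n₁ n₂ : ℝ) : ℝ :=
  (1 / (4 * π)) * Real.exp (-(π * (m₁ ^ 2 + m₂ ^ 2)) - π * (n₁ ^ 2 + n₂ ^ 2))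
    * hermiteP d₁ (Real.sqrt π * (m₁ + n₁)) * hermiteP d₂ (Real.sqrt π * (m₂ + n₂))


noncomputable def pfG (t a : ℝ) : ℂ := Complex.exp (-π * a ^ 2 + 2 * π * Complex.I * (a * t))

theorem pfG_int (t : ℝ) (k : ℕ) : Integrable (fun a : ℝ => (a : ℂ) ^ k * pfG t a) := by
  have h := integrable_rpow_mul_exp_neg_mul_sq Real.pi_pos (s := (k : ℝ))
    (by have : (0 : ℝ) ≤ k := Nat.cast_nonneg k
        linarith)
  refine h.mono (Continuous.aestronglyMeasurable (by unfold pfG; fun_prop)) ?_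
  refine Filter.Eventually.of_forall fun a => ?_
  have h2 : ‖pfG t a‖ = Real.exp (-π * a ^ 2) := by
    unfold pfG
    rw [Complex.norm_exp]
    congr 1
    simp [pow_two]
  rw [norm_mul, norm_mul, h2, norm_pow, Real.rpow_natCast]
  simp

theorem pfG_deriv (t a : ℝ) :
    HasDerivAt (pfG t) ((-2 * π * a + 2 * π * Complex.I * t) * pfG t a) a := by
  unfold pfG
  have h0 : HasDerivAt (fun x : ℝ => (x : ℂ)) 1 a := Complex.ofRealCLM.hasDerivAt
  have h1 := (((h0.pow 2).const_mul (-π : ℂ)).add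
    ((h0.mul_const (t : ℂ)).const_mul (2 * π * Complex.I))).cexp
  refine h1.congr_deriv ?_
  simp
  ring

theorem pfM0 (t : ℝ) : ∫ a : ℝ, pfG t a = Complex.exp (-(π * t ^ 2)) := by
  have hπ : (π : ℂ) ≠ 0 := by exact_mod_cast Real.pi_ne_zero
  have h := integral_cexp_quadratic (b := -(π : ℂ)) (by simp [Real.pi_pos]) (2 * π * Complex.I * t) 0
  rw [neg_neg, div_self hπ, Complex.one_cpow, one_mul] at h
  have e : (0 - (2 * π * Complex.I * t) ^ 2 / (4 * -(π : ℂ)) : ℂ) = -(π * t ^ 2) := by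
    field_simp
    ring_nf
    simp
    try ring
  rw [e] at h
  rw [← h]
  congr 1
  ext a
  unfold pfG
  congr 1
  ring

theorem pfI0 (t : ℝ) : Integrable (fun a : ℝ => pfG t a) := by simpa using pfG_int t 0
theorem pfI1 (t : ℝ) : Integrable (fun a : ℝ => (a : ℂ) * pfG t a) := by simpa using pfG_int t 1

theorem pfM1 (t : ℝ) : ∫ a : ℝ, (a : ℂ) * pfG t a = Complex.I * t * Complex.exp (-(π * t ^ 2)) := by
  have hπ : (π : ℂ) ≠ 0 := by exact_mod_cast Real.pi_ne_zero
  have e : (fun a : ℝ => (-2 * π * a + 2 * π * Complex.I * t) * pfG t a) =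
      fun a : ℝ => (-2 * π : ℂ) * ((a : ℂ) * pfG t a) + (2 * π * Complex.I * t) * pfG t a := by
    ext a; ring
  have i1 := (pfI1 t).const_mul (-2 * π : ℂ)
  have i0 := (pfI0 t).const_mul (2 * π * Complex.I * t)
  have h := integral_eq_zero_of_hasDerivAt_of_integrable (pfG_deriv t)
    (by rw [e]; exact i1.add i0) (pfI0 t)
  rw [e, integral_add i1 i0, integral_const_mul, integral_const_mul, pfM0] at h
  apply mul_left_cancel₀ (mul_ne_zero (two_ne_zero) hπ)
  linear_combination -h

theorem pfM2 (t : ℝ) : ∫ a : ℝ, (a : ℂ) ^ 2 * pfG t a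
    = (1 / (2 * π) - t ^ 2) * Complex.exp (-(π * t ^ 2)) := by
  have hπ : (π : ℂ) ≠ 0 := by exact_mod_cast Real.pi_ne_zero
  have i2 := (pfG_int t 2).const_mul (-2 * π : ℂ)
  have i1 := (pfI1 t).const_mul (2 * π * Complex.I * t)
  have i0 := pfI0 t
  have e : (fun a : ℝ => 1 * pfG t a + (a : ℂ) * ((-2 * π * a + 2 * π * Complex.I * t) * pfG t a)) =
      fun a : ℝ => ((-2 * π : ℂ) * ((a : ℂ) ^ 2 * pfG t a) +
        (2 * π * Complex.I * t) * ((a : ℂ) * pfG t a)) + pfG t a := by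
    ext a; ring
  have d : ∀ a : ℝ, HasDerivAt (fun a : ℝ => (a : ℂ) * pfG t a)
      (1 * pfG t a + (a : ℂ) * ((-2 * π * a + 2 * π * Complex.I * t) * pfG t a)) a := fun a =>
    HasDerivAt.mul (c := fun a : ℝ => (a : ℂ)) Complex.ofRealCLM.hasDerivAt (pfG_deriv t a)
  have h := integral_eq_zero_of_hasDerivAt_of_integrable d
    (by rw [e]; exact (i2.add i1).add i0) (pfI1 t)
  rw [e, integral_add (by exact i2.add i1) i0, integral_add i2 i1, integral_const_mul, integral_const_mul,
    pfM0, pfM1] at h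
  apply mul_left_cancel₀ (mul_ne_zero (two_ne_zero) hπ)
  have : (2 * π : ℂ) * ((1 / (2 * π) - t ^ 2) * Complex.exp (-(π * t ^ 2))) =
      (1 - 2 * π * t ^ 2) * Complex.exp (-(π * t ^ 2)) := by field_simp
  rw [this]
  linear_combination -h + 2 * π * t ^ 2 * Complex.exp (-(π * t ^ 2)) * Complex.I_sq

theorem pfH1 (t c : ℝ) : ∫ a : ℝ, (hermiteP 1 (√π * (a + c)) : ℂ) * pfG t a =
    2 * (√π : ℂ) * Complex.I * (t - Complex.I * c) * Complex.exp (-(π * t ^ 2)) := by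
  have e : (fun a : ℝ => (hermiteP 1 (√π * (a + c)) : ℂ) * pfG t a) =
      fun a : ℝ => (2 * (√π : ℂ)) * ((a : ℂ) * pfG t a) + (2 * (√π : ℂ) * c) * pfG t a := by
    ext a; simp only [hermiteP]; push_cast; ring
  rw [e, integral_add ((pfI1 t).const_mul _) ((pfI0 t).const_mul _), integral_const_mul,
    integral_const_mul, pfM0, pfM1]
  linear_combination 2 * (√π : ℂ) * c * Complex.exp (-(π * t ^ 2)) * Complex.I_sq

theorem pf_sqrt : (√π : ℂ) ^ 2 = π := by
  exact_mod_cast Real.sq_sqrt Real.pi_pos.le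

theorem pfH2 (t c : ℝ) : ∫ a : ℝ, (hermiteP 2 (√π * (a + c)) : ℂ) * pfG t a =
    -4 * π * (t - Complex.I * c) ^ 2 * Complex.exp (-(π * t ^ 2)) := by
  have hπ : (π : ℂ) ≠ 0 := by exact_mod_cast Real.pi_ne_zero
  have e : (fun a : ℝ => (hermiteP 2 (√π * (a + c)) : ℂ) * pfG t a) =
      fun a : ℝ => ((4 * π : ℂ) * ((a : ℂ) ^ 2 * pfG t a) + (8 * π * c : ℂ) * ((a : ℂ) * pfG t a))
        + (4 * π * c ^ 2 - 2 : ℂ) * pfG t a := by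
    ext a; simp only [hermiteP]; push_cast
    linear_combination 4 * (a + c) ^ 2 * pfG t a * pf_sqrt
  have i2 := (pfG_int t 2).const_mul (4 * π : ℂ)
  have i1 := (pfI1 t).const_mul (8 * π * c : ℂ)
  rw [e, integral_add (by exact i2.add i1) ((pfI0 t).const_mul _), integral_add i2 i1, integral_const_mul,
    integral_const_mul, integral_const_mul, pfM0, pfM1, pfM2]
  have : (4 * π : ℂ) * ((1 / (2 * π) - t ^ 2) * Complex.exp (-(π * t ^ 2))) =
      (2 - 4 * π * t ^ 2) * Complex.exp (-(π * t ^ 2)) := by field_simp; ring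
  rw [this]
  linear_combination 4 * π * c ^ 2 * Complex.exp (-(π * t ^ 2)) * Complex.I_sq

theorem pfH0 (t c : ℝ) : ∫ a : ℝ, (hermiteP 0 (√π * (a + c)) : ℂ) * pfG t a =
    Complex.exp (-(π * t ^ 2)) := by
  simp [hermiteP, pfM0]

/-- The partial Fourier transform `φ̂(A) = ∫_{ℝ²} φ([[a,n₁],[m₂,b]]) e^{2πi(an₂ − bm₁)} da db`
of `φ_{(d₁,d₂)}` in the entries `m₁` and `n₂`, for `(d₁,d₂) ∈ {(2,0),(0,2),(1,1)}`, equals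
`−(n₂ − in₁)^{d₁}(−m₁ − im₂)^{d₂} e^{−π(m₁² + m₂² + n₁² + n₂²)}`. -/
theorem partial_fourier_phi (d₁ d₂ : ℕ)
    (h : (d₁, d₂) = (2, 0) ∨ (d₁, d₂) = (0, 2) ∨ (d₁, d₂) = (1, 1))
    (m₁ m₂ n₁ n₂ : ℝ) :
    (∫ a : ℝ, ∫ b : ℝ, (phi d₁ d₂ a m₂ n₁ b : ℂ)
        * Complex.exp (2 * π * Complex.I * (a * n₂ - b * m₁)))
      = -((n₂ : ℂ) - Complex.I * n₁) ^ d₁ * (-(m₁ : ℂ) - Complex.I * m₂) ^ d₂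
        * Complex.exp (-(π * (m₁ ^ 2 + m₂ ^ 2 + n₁ ^ 2 + n₂ ^ 2))) := by
  have hπ : (π : ℂ) ≠ 0 := by exact_mod_cast Real.pi_ne_zero
  have e : ∀ a b : ℝ, (phi d₁ d₂ a m₂ n₁ b : ℂ)
        * Complex.exp (2 * π * Complex.I * (a * n₂ - b * m₁)) =
      ((1 / (4 * π) : ℂ) * Complex.exp (-(π * (m₂ ^ 2 + n₁ ^ 2)))
        * ((hermiteP d₁ (√π * (a + n₁)) : ℂ) * pfG n₂ a))
        * ((hermiteP d₂ (√π * (b + m₂)) : ℂ) * pfG (-m₁) b) := by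
    intro a b
    have hx : Complex.exp (-(π * (a ^ 2 + m₂ ^ 2)) - π * (n₁ ^ 2 + b ^ 2))
        * Complex.exp (2 * π * Complex.I * (a * n₂ - b * m₁)) =
        Complex.exp (-(π * (m₂ ^ 2 + n₁ ^ 2))) * pfG n₂ a * pfG (-m₁) b := by
      unfold pfG
      rw [← Complex.exp_add, ← Complex.exp_add, ← Complex.exp_add]
      congr 1
      push_cast
      ring
    unfold phi
    rw [add_comm m₂ b]
    push_cast
    linear_combination (1 / (4 * π) : ℂ) * (hermiteP d₁ (√π * (a + n₁)) : ℂ)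
      * (hermiteP d₂ (√π * (b + m₂)) : ℂ) * hx
  have hE : Complex.exp (-(π * (m₁ ^ 2 + m₂ ^ 2 + n₁ ^ 2 + n₂ ^ 2))) =
      Complex.exp (-(π * (m₂ ^ 2 + n₁ ^ 2))) * Complex.exp (-(π * n₂ ^ 2))
        * Complex.exp (-(π * ((-m₁ : ℝ) : ℂ) ^ 2)) := by
    rw [← Complex.exp_add, ← Complex.exp_add]
    congr 1
    push_cast
    ring
  simp only [e]
  simp only [integral_const_mul, integral_mul_const]
  rw [hE]
  rcases h with h | h | h <;> obtain ⟨rfl, rfl⟩ := Prod.mk.inj h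
  · rw [pfH2, pfH0]
    field_simp
    try ring
  · rw [pfH2, pfH0]
    push_cast
    field_simp
    try ring
  · rw [pfH1, pfH1]
    have hs := pf_sqrt
    have hI := Complex.I_sq
    generalize Complex.exp (-(π * (m₂ ^ 2 + n₁ ^ 2))) = A
    generalize Complex.exp (-(π * n₂ ^ 2)) = B
    generalize Complex.exp (-(π * ((-m₁ : ℝ) : ℂ) ^ 2)) = C
    push_cast
    have : ∀ X Y : ℂ, 1 / (4 * (π : ℂ)) * A * (2 * (√π : ℂ) * Complex.I * X * B)
        * (2 * (√π : ℂ) * Complex.I * Y * C) = - X * Y * (A * B * C) := by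
      intro X Y
      have h4 : 1 / (4 * (π : ℂ)) * (4 * π) = 1 := by field_simp
      linear_combination (1 / (4 * (π : ℂ)) * A * B * C * X * Y * 4 * Complex.I ^ 2) * hs
        + (1 / (4 * (π : ℂ)) * (4 * π) * A * B * C * X * Y) * hI - A * B * C * X * Y * h4
    rw [this]
    ring
end

section
/- For A = [[m₁, n₁],[m₂, n₂]] ∈ M₂(ℝ), define the partial Fourier transform in the second column φ̃(A) := ∫_{ℝ²} φ([[m₁, a],[m₂, b]])·e^{2πi(a·n₁ + b·n₂)} da db. Then φ̃_{(1,1)}([[m₁, n₁],[m₂, n₂]]) = −(n₁ − i·m₁)·(n₂ − i·m₂)·e^{−π(m₁² + m₂² + n₁² + n₂²)}. -/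
open MeasureTheory Real Complex

/-- The Schwartz function `φ_{(1,1)}` on `2×2` real matrices `[[m₁,n₁],[m₂,n₂]]`
(identified with the pair of columns `m = (m₁,m₂)`, `n = (n₁,n₂)`), with `H₁(t) = 2t`:
`φ_{(1,1)}(m,n) = (1/4π) e^{−π‖m‖² − π‖n‖²} H₁(√π(m₁+n₁)) H₁(√π(m₂+n₂))`. -/
noncomputable def phi11 (m₁ m₂ n₁ n₂ : ℝ) : ℝ :=
  (1 / (4 * π)) * Real.exp (-(π * (m₁ ^ 2 + m₂ ^ 2)) - π * (n₁ ^ 2 + n₂ ^ 2))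
    * (2 * (Real.sqrt π * (m₁ + n₁))) * (2 * (Real.sqrt π * (m₂ + n₂)))

lemma aux_int (n : ℝ) : Integrable (fun a : ℝ => Complex.exp (-π * (a:ℂ) ^ 2 + (2 * π * Complex.I * n) * a + 0)) := by
  have := integrable_cexp_quadratic (b := (π : ℂ)) (by simpa using Real.pi_pos) (2 * π * Complex.I * n) 0
  exact this

lemma aux_int' (n : ℝ) : Integrable (fun a : ℝ => (a : ℂ) * Complex.exp (-π * (a:ℂ) ^ 2 + (2 * π * Complex.I * n) * a + 0)) := by
  have h := (integrable_mul_exp_neg_mul_sq Real.pi_pos).norm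
  refine h.mono' (by fun_prop) ?_
  filter_upwards with a
  rw [norm_mul, norm_mul, Complex.norm_exp, Complex.norm_real, Real.norm_eq_abs (Real.exp _), abs_of_pos (Real.exp_pos _)]
  apply le_of_eq
  congr 2
  simp [← Complex.ofReal_pow]

lemma aux_val (n : ℝ) : ∫ a : ℝ, Complex.exp (-π * (a:ℂ) ^ 2 + (2 * π * Complex.I * n) * a + 0) = Complex.exp (-(π * n ^ 2)) := by
  have hp : (π : ℂ) ≠ 0 := by exact_mod_cast Real.pi_ne_zero
  rw [integral_cexp_quadratic (by simpa using Real.pi_pos)]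
  rw [neg_neg, div_self hp, Complex.one_cpow, one_mul]
  congr 1
  field_simp
  ring_nf
  simp [Complex.I_sq]

lemma aux_one (m n : ℝ) : ∫ a : ℝ, ((m : ℂ) + a) * Complex.exp (-π * (a:ℂ) ^ 2 + (2 * π * Complex.I * n) * a + 0) = (m + Complex.I * n) * Complex.exp (-(π * n ^ 2)) := by
  have hp : (π : ℂ) ≠ 0 := by exact_mod_cast Real.pi_ne_zero
  have h1 := aux_int n
  have h2 := aux_int' n
  have hv := aux_val n
  have hd : ∀ a : ℝ, HasDerivAt (fun a : ℝ => Complex.exp (-π * (a:ℂ) ^ 2 + (2 * π * Complex.I * n) * a + 0))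
      ((-2 * π) * ((a : ℂ) * Complex.exp (-π * (a:ℂ) ^ 2 + (2 * π * Complex.I * n) * a + 0))
        + (2 * π * Complex.I * n) * Complex.exp (-π * (a:ℂ) ^ 2 + (2 * π * Complex.I * n) * a + 0)) a := by
    intro a
    have h0 : HasDerivAt (fun z : ℂ => Complex.exp (-π * z ^ 2 + (2 * π * Complex.I * n) * z + 0)) _ (a : ℂ) :=
      (((((hasDerivAt_id (a : ℂ)).pow 2).const_mul (-π : ℂ)).add
        ((hasDerivAt_id (a : ℂ)).const_mul (2 * π * Complex.I * n))).add_const 0).cexp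
    convert h0.comp_ofReal using 1
    simp
    ring
  have hz := integral_eq_zero_of_hasDerivAt_of_integrable hd
    ((h2.const_mul _).add (h1.const_mul _)) h1
  rw [integral_add (h2.const_mul _) (h1.const_mul _), integral_const_mul, integral_const_mul, hv] at hz
  simp_rw [add_mul]
  rw [integral_add (h1.const_mul _) h2, integral_const_mul, hv]
  have : (2 * π : ℂ) ≠ 0 := by simpa using hp
  apply mul_left_cancel₀ this
  linear_combination -hz

/-- The partial Fourier transform in the second column,
`φ̃(A) = ∫_{ℝ²} φ([[m₁,a],[m₂,b]]) e^{2πi(an₁ + bn₂)} da db`, of `φ_{(1,1)}` equals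
`−(n₁ − im₁)(n₂ − im₂) e^{−π(m₁² + m₂² + n₁² + n₂²)}`. -/
theorem partial_fourier_phi11_second_column (m₁ m₂ n₁ n₂ : ℝ) :
    (∫ a : ℝ, ∫ b : ℝ, (phi11 m₁ m₂ a b : ℂ)
        * Complex.exp (2 * π * Complex.I * (a * n₁ + b * n₂)))
      = -(((n₁ : ℂ) - Complex.I * m₁) * ((n₂ : ℂ) - Complex.I * m₂))
        * Complex.exp (-(π * (m₁ ^ 2 + m₂ ^ 2 + n₁ ^ 2 + n₂ ^ 2))) := by
  have hp : (π : ℂ) ≠ 0 := by exact_mod_cast Real.pi_ne_zero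
  have hs : ((Real.sqrt π : ℝ) : ℂ) ^ 2 = π := by
    rw [← Complex.ofReal_pow, Real.sq_sqrt Real.pi_pos.le]
  have key : ∀ a b : ℝ, (phi11 m₁ m₂ a b : ℂ)
        * Complex.exp (2 * π * Complex.I * (a * n₁ + b * n₂))
      = (Complex.exp (-(π * (m₁ ^ 2 + m₂ ^ 2))) * (((m₁ : ℂ) + a) * Complex.exp (-π * (a:ℂ) ^ 2 + (2 * π * Complex.I * n₁) * a + 0)))
        * (((m₂ : ℂ) + b) * Complex.exp (-π * (b:ℂ) ^ 2 + (2 * π * Complex.I * n₂) * b + 0)) := by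
    intro a b
    have he : Complex.exp (-(π * (m₁ ^ 2 + m₂ ^ 2)) - π * (a ^ 2 + b ^ 2)) * Complex.exp (2 * π * Complex.I * (a * n₁ + b * n₂))
      = Complex.exp (-(π * (m₁ ^ 2 + m₂ ^ 2))) * Complex.exp (-π * (a:ℂ) ^ 2 + (2 * π * Complex.I * n₁) * a + 0) * Complex.exp (-π * (b:ℂ) ^ 2 + (2 * π * Complex.I * n₂) * b + 0) := by
      rw [← Complex.exp_add, ← Complex.exp_add, ← Complex.exp_add]
      congr 1
      ring
    have hc : (1 / (4 * π) : ℂ) * (4 * ((Real.sqrt π : ℝ) : ℂ) ^ 2) = 1 := by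
      rw [hs]; field_simp
    unfold phi11
    push_cast
    linear_combination ((m₁ : ℂ) + a) * (m₂ + b) * he + ((m₁ : ℂ) + a) * (m₂ + b) * Complex.exp (-(π * (m₁ ^ 2 + m₂ ^ 2)) - π * (a ^ 2 + b ^ 2)) * Complex.exp (2 * π * Complex.I * (a * n₁ + b * n₂)) * hc
  simp_rw [key, integral_const_mul, integral_mul_const, integral_const_mul, aux_one]
  have he : Complex.exp (-(π * (m₁ ^ 2 + m₂ ^ 2 + n₁ ^ 2 + n₂ ^ 2))) = Complex.exp (-(π * (m₁ ^ 2 + m₂ ^ 2))) * Complex.exp (-(π * n₁ ^ 2)) * Complex.exp (-(π * n₂ ^ 2)) := by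
    rw [← Complex.exp_add, ← Complex.exp_add]
    congr 1
    ring
  rw [he]
  ring_nf
  simp only [Complex.I_sq]
  ring
end

section
/- Fix integers N ≥ 1 and n ≥ 1, and let Γ := Γ₁(N) ≤ SL₂(ℤ) be the subgroup of matrices [[a,b],[c,d]] with a ≡ 1, d ≡ 1, c ≡ 0 (mod N). Let Δ := {A ∈ M₂(ℤ) : det A = n, A₁₁ ≡ 1 (mod N), A₂₁ ≡ 0 (mod N)}, on which Γ acts by left matrix multiplication. Let L := {[[m₁, n₁],[m₂, n₂]] ∈ M₂(ℤ) : m₁ ≡ 1 (mod N), m₂ ≡ 0 (mod N), m₁n₁ + m₂n₂ = n}, on which Γ acts by ρ_γ([m | n]) := [γ·m | (γᵀ)⁻¹·n], where m = (m₁,m₂) and n = (n₁,n₂) are the columns. Then the map [[m₁, n₁],[m₂, n₂]] ↦ [[m₁, n₂],[−m₂, n₁]] sends Δ into L and induces a bijection between the orbit spaces Γ\Δ and Γ\L. -/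
open Matrix

/-- `Γ₁(N)`: integer matrices of determinant `1` with `a ≡ 1`, `d ≡ 1`, `c ≡ 0 (mod N)`. -/
def Gamma1 (N : ℕ) : Set (Matrix (Fin 2) (Fin 2) ℤ) :=
  {g | g.det = 1 ∧ g 0 0 ≡ 1 [ZMOD N] ∧ g 1 1 ≡ 1 [ZMOD N] ∧ g 1 0 ≡ 0 [ZMOD N]}

/-- `Δ`: integer matrices of determinant `n` with top-left entry `≡ 1` and bottom-left
entry `≡ 0 (mod N)`. -/
def DeltaSet (N n : ℕ) : Set (Matrix (Fin 2) (Fin 2) ℤ) :=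
  {A | A.det = n ∧ A 0 0 ≡ 1 [ZMOD N] ∧ A 1 0 ≡ 0 [ZMOD N]}

/-- `L`: matrices `[[m₁,n₁],[m₂,n₂]]` with `m₁ ≡ 1`, `m₂ ≡ 0 (mod N)` and
`m₁n₁ + m₂n₂ = n`. -/
def LSet (N n : ℕ) : Set (Matrix (Fin 2) (Fin 2) ℤ) :=
  {A | A 0 0 ≡ 1 [ZMOD N] ∧ A 1 0 ≡ 0 [ZMOD N] ∧ A 0 0 * A 0 1 + A 1 0 * A 1 1 = n}

/-- The twisted action `ρ_γ([m | n]) = [γ·m | (γᵀ)⁻¹·n]` on the columns `m, n` of a matrix,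
written as `γ·A·E₀ + (γᵀ)⁻¹·A·E₁` with `E₀ = [[1,0],[0,0]]`, `E₁ = [[0,0],[0,1]]`. -/
noncomputable def rhoAct (γ A : Matrix (Fin 2) (Fin 2) ℤ) : Matrix (Fin 2) (Fin 2) ℤ :=
  γ * A * !![1, 0; 0, 0] + (γᵀ)⁻¹ * A * !![0, 0; 0, 1]

/-- The map `[[m₁,n₁],[m₂,n₂]] ↦ [[m₁,n₂],[−m₂,n₁]]`. -/
def colSwap (A : Matrix (Fin 2) (Fin 2) ℤ) : Matrix (Fin 2) (Fin 2) ℤ :=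
  !![A 0 0, A 1 1; -(A 1 0), A 0 1]

def twist (g : Matrix (Fin 2) (Fin 2) ℤ) : Matrix (Fin 2) (Fin 2) ℤ :=
  !![g 0 0, -(g 0 1); -(g 1 0), g 1 1]

theorem colSwap_colSwap (A : Matrix (Fin 2) (Fin 2) ℤ) : colSwap (colSwap A) = A := by
  ext i j; fin_cases i <;> fin_cases j <;> simp [colSwap]

theorem twist_twist (A : Matrix (Fin 2) (Fin 2) ℤ) : twist (twist A) = A := by
  ext i j; fin_cases i <;> fin_cases j <;> simp [twist]

theorem neg_modEq_zero' {N : ℕ} {a : ℤ} (h : a ≡ 0 [ZMOD N]) : -a ≡ 0 [ZMOD N] := by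
  simpa using h.neg

theorem twist_mem {N : ℕ} {g : Matrix (Fin 2) (Fin 2) ℤ} (h : g ∈ Gamma1 N) :
    twist g ∈ Gamma1 N := by
  obtain ⟨h1, h2, h3, h4⟩ := h
  rw [det_fin_two] at h1
  refine ⟨?_, ?_, ?_, ?_⟩
  · rw [det_fin_two]; simp [twist]; linarith
  · simpa [twist] using h2
  · simpa [twist] using h3
  · simpa [twist] using neg_modEq_zero' h4

theorem colSwap_mem {N n : ℕ} {A : Matrix (Fin 2) (Fin 2) ℤ} (h : A ∈ DeltaSet N n) :
    colSwap A ∈ LSet N n := by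
  obtain ⟨h1, h2, h3⟩ := h
  rw [det_fin_two] at h1
  refine ⟨?_, ?_, ?_⟩
  · simpa [colSwap] using h2
  · simpa [colSwap] using neg_modEq_zero' h3
  · simp [colSwap]; linarith

theorem colSwap_mem' {N n : ℕ} {A : Matrix (Fin 2) (Fin 2) ℤ} (h : A ∈ LSet N n) :
    colSwap A ∈ DeltaSet N n := by
  obtain ⟨h2, h3, h1⟩ := h
  refine ⟨?_, ?_, ?_⟩
  · rw [det_fin_two]; simp [colSwap]; linarith
  · simpa [colSwap] using h2
  · simpa [colSwap] using neg_modEq_zero' h3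

theorem colSwap_mul {N : ℕ} {g : Matrix (Fin 2) (Fin 2) ℤ} (h : g ∈ Gamma1 N)
    (A : Matrix (Fin 2) (Fin 2) ℤ) :
    colSwap (g * A) = rhoAct (twist g) (colSwap A) := by
  have hd : ((twist g)ᵀ).det = 1 := by rw [det_transpose]; exact (twist_mem h).1
  have hi : ((twist g)ᵀ)⁻¹ = !![g 1 1, g 1 0; g 0 1, g 0 0] := by
    rw [Matrix.inv_def, hd, adjugate_fin_two]
    simp [twist]
  unfold rhoAct
  rw [hi]
  ext i j
  fin_cases i <;> fin_cases j <;>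
    simp [colSwap, twist, Matrix.mul_apply, Fin.sum_univ_two] <;> ring

/-- The map `[[m₁,n₁],[m₂,n₂]] ↦ [[m₁,n₂],[−m₂,n₁]]` sends `Δ` into `L` and induces a
bijection between the orbit spaces `Γ\Δ` (under left multiplication) and `Γ\L`
(under the twisted action `ρ`), where `Γ = Γ₁(N)`. -/
theorem delta_orbits_equiv_L_orbits (N n : ℕ) (hN : 1 ≤ N) (hn : 1 ≤ n) :
    ∃ hmap : ∀ A ∈ DeltaSet N n, colSwap A ∈ LSet N n,
      ∃ F : Quot (fun (A B : DeltaSet N n) => ∃ γ ∈ Gamma1 N, (B : Matrix (Fin 2) (Fin 2) ℤ) = γ * A)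
            ≃ Quot (fun (A B : LSet N n) => ∃ γ ∈ Gamma1 N, (B : Matrix (Fin 2) (Fin 2) ℤ) = rhoAct γ A),
        ∀ A : DeltaSet N n,
          F (Quot.mk _ A) = Quot.mk _ ⟨colSwap (A : Matrix (Fin 2) (Fin 2) ℤ), hmap A A.2⟩ := by
  refine ⟨fun A hA => colSwap_mem hA, Quot.congr
    ⟨fun A => ⟨colSwap A, colSwap_mem A.2⟩, fun A => ⟨colSwap A, colSwap_mem' A.2⟩,
      fun A => Subtype.ext (colSwap_colSwap _), fun A => Subtype.ext (colSwap_colSwap _)⟩ ?_,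
    fun A => rfl⟩
  intro A B
  constructor
  · rintro ⟨g, hg, h⟩
    refine ⟨twist g, twist_mem hg, ?_⟩
    simp only [Equiv.coe_fn_mk]
    rw [h, colSwap_mul hg]
  · rintro ⟨g, hg, h⟩
    refine ⟨twist g, twist_mem hg, ?_⟩
    simp only [Equiv.coe_fn_mk] at h
    have h2 := colSwap_mul (twist_mem hg) A.1
    rw [twist_twist, ← h] at h2
    rw [← colSwap_colSwap (twist g * A.1), h2, colSwap_colSwap]
end

section
/- Let N ≥ 2 be an integer. For every γ ∈ Γ₁(N) there exists a positive integer m divisible by N such that, setting ρ := [[1 + m², m],[m, 1]], one has: ρ ∈ Γ₁(N), |tr(ρ)| > 2, and |tr(γ·ρ)| > 2. In particular, every element of Γ₁(N) can be written as σ·ρ⁻¹ with σ, ρ ∈ Γ₁(N) both hyperbolic (i.e. of trace of absolute value greater than 2). -/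
open Matrix

/-- For every `γ ∈ Γ₁(N)` (with `N ≥ 2`) there is a positive multiple `m` of `N` such that
`ρ = [[1 + m², m],[m, 1]]` lies in `Γ₁(N)` and both `ρ` and `γρ` are hyperbolic
(`|trace| > 2`). In particular every element of `Γ₁(N)` is `σ·ρ⁻¹` with `σ, ρ ∈ Γ₁(N)`
hyperbolic. -/
theorem gamma1_eq_product_of_hyperbolic (N : ℕ) (hN : 2 ≤ N)
    (γ : Matrix (Fin 2) (Fin 2) ℤ) (hγ : γ ∈ Gamma1 N) :
    (∃ m : ℤ, 0 < m ∧ (N : ℤ) ∣ m ∧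
      (!![1 + m ^ 2, m; m, 1] : Matrix (Fin 2) (Fin 2) ℤ) ∈ Gamma1 N ∧
      2 < |(!![1 + m ^ 2, m; m, 1] : Matrix (Fin 2) (Fin 2) ℤ).trace| ∧
      2 < |(γ * !![1 + m ^ 2, m; m, 1]).trace|) ∧
    ∃ σ ρ : Matrix (Fin 2) (Fin 2) ℤ, σ ∈ Gamma1 N ∧ ρ ∈ Gamma1 N ∧
      2 < |σ.trace| ∧ 2 < |ρ.trace| ∧ γ = σ * ρ⁻¹ := by
  obtain ⟨hdet, ha, hd, hc⟩ := hγ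
  have ha0 : γ 0 0 ≠ 0 := by
    intro h
    rw [h] at ha
    have h1 : (N : ℤ) ∣ 1 := by simpa using ha.dvd
    have h2 := Int.le_of_dvd one_pos h1
    omega
  have key : ∃ m : ℤ, 0 < m ∧ (N : ℤ) ∣ m ∧
      (!![1 + m ^ 2, m; m, 1] : Matrix (Fin 2) (Fin 2) ℤ) ∈ Gamma1 N ∧
      2 < |(!![1 + m ^ 2, m; m, 1] : Matrix (Fin 2) (Fin 2) ℤ).trace| ∧
      2 < |(γ * !![1 + m ^ 2, m; m, 1]).trace| := by
    obtain ⟨K, hK⟩ : ∃ K : ℤ, K = |γ 0 1 + γ 1 0| + |γ 0 0 + γ 1 1| + 3 := ⟨_, rfl⟩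
    have hs := abs_nonneg (γ 0 1 + γ 1 0)
    have ht := abs_nonneg (γ 0 0 + γ 1 1)
    have hN' : (2 : ℤ) ≤ N := by exact_mod_cast hN
    obtain ⟨m, hm⟩ : ∃ m : ℤ, m = N * K := ⟨_, rfl⟩
    have hmK : K ≤ m := by nlinarith
    have hdvd : (N : ℤ) ∣ m := ⟨K, hm⟩
    have hm0 : m ≡ 0 [ZMOD N] := (Int.modEq_zero_iff_dvd).2 hdvd
    refine ⟨m, by omega, hdvd, ⟨?_, ?_, ?_, ?_⟩, ?_, ?_⟩
    · simp [Matrix.det_fin_two]; ring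
    · simpa using (hm0.pow 2).add_left 1
    · simp
    · simpa using hm0
    · simp only [Matrix.trace_fin_two, Matrix.of_apply, Matrix.cons_val', Matrix.cons_val_zero,
        Matrix.cons_val_one, Matrix.cons_val_fin_one]
      exact lt_of_lt_of_le (by nlinarith) (le_abs_self _)
    · have htr : (γ * !![1 + m ^ 2, m; m, 1]).trace
          = γ 0 0 * m ^ 2 + (γ 0 1 + γ 1 0) * m + (γ 0 0 + γ 1 1) := by
        simp [Matrix.trace_fin_two, Matrix.mul_apply, Fin.sum_univ_two]; ring
      rw [htr]
      have s1 := le_abs_self (γ 0 1 + γ 1 0)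
      have s2 := neg_abs_le (γ 0 1 + γ 1 0)
      have t1 := le_abs_self (γ 0 0 + γ 1 1)
      have t2 := neg_abs_le (γ 0 0 + γ 1 1)
      generalize γ 0 1 + γ 1 0 = s at *
      generalize γ 0 0 + γ 1 1 = t at *
      have hmm : |t| + 3 ≤ m * (m - |s|) := by nlinarith
      have hmp : 0 < m := by omega
      rcases lt_or_gt_of_ne ha0 with h | h
      · rw [lt_abs]; right
        have h1 : m ^ 2 ≤ -γ 0 0 * m ^ 2 := by nlinarith [sq_nonneg m]
        have h2 : s * m ≤ |s| * m := by nlinarith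
        nlinarith
      · rw [lt_abs]; left
        have h1 : m ^ 2 ≤ γ 0 0 * m ^ 2 := by nlinarith [sq_nonneg m]
        have h2 : -|s| * m ≤ s * m := by nlinarith
        nlinarith
  refine ⟨key, ?_⟩
  obtain ⟨m, -, hdvd, hρ, h1, h2⟩ := key
  refine ⟨_, _, ?_, hρ, h2, h1, ?_⟩
  · have hm0 : m ≡ 0 [ZMOD N] := (Int.modEq_zero_iff_dvd).2 hdvd
    refine ⟨by rw [Matrix.det_mul, hdet, hρ.1, one_mul], ?_, ?_, ?_⟩
    · simpa [Matrix.mul_apply, Fin.sum_univ_two] using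
        (ha.mul ((hm0.pow 2).add_left 1)).add (hm0.mul_left (γ 0 1))
    · simpa [Matrix.mul_apply, Fin.sum_univ_two] using
        (hm0.mul_left (γ 1 0)).add hd
    · simpa [Matrix.mul_apply, Fin.sum_univ_two] using
        (hc.mul_right (1 + m ^ 2)).add (hm0.mul_left (γ 1 1))
  · rw [Matrix.mul_nonsing_inv_cancel_right]
    rw [hρ.1]; exact isUnit_one
end

section
/- For all real numbers A > 0, B > 0 and every real s with −2 < s < 2: ∫₀^∞ ∫₀^∞ e^{−π·v·t²·A − π·(v/t²)·B} · v² · t^{2s} · (dv/v)·(dt/t) = (1/4)·Γ(1 + s/2)·Γ(1 − s/2)·π^{−2}·A^{−1−s/2}·B^{−1+s/2}. -/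
open MeasureTheory Real

noncomputable def thetaAux (A B s : ℝ) (x v : ℝ) : ℝ :=
  (1 / 2 * rexp (-(π * A) * x ^ (1:ℝ)) * x ^ (s - 1)) * (v ^ (1 - s) * rexp (-(π * B / x) * v ^ (2:ℝ)))

lemma thetaAux_inner (A B s v : ℝ) (hv : 0 < v) :
    (∫ t in Set.Ioi (0 : ℝ),
        Real.exp (-(π * v * t ^ 2 * A) - π * (v / t ^ 2) * B) * v ^ 2 * t ^ (2 * s)
          * (1 / v) * (1 / t)) = ∫ x in Set.Ioi (0 : ℝ), thetaAux A B s x v := by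
  have h1 := integral_comp_mul_left_Ioi (fun x => thetaAux A B s x v) 0 hv
  rw [mul_zero, smul_eq_mul] at h1
  have h2 := integral_comp_rpow_Ioi_of_pos (g := fun y => thetaAux A B s (v * y) v) (p := 2) two_pos
  rw [h1] at h2
  have h3 : (∫ x in Set.Ioi (0 : ℝ), thetaAux A B s x v) =
      v * (v⁻¹ * ∫ x in Set.Ioi (0 : ℝ), thetaAux A B s x v) := by
    field_simp
  rw [h3, ← h2, ← integral_const_mul]
  refine setIntegral_congr_fun measurableSet_Ioi fun t ht => ?_
  have ht : 0 < t := ht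
  have e1 : t ^ (2:ℝ) = t ^ 2 := by norm_cast
  have e2 : v ^ (2:ℝ) = v ^ 2 := by norm_cast
  have e3 : t ^ (2 - 1 : ℝ) = t := by norm_num
  simp only [thetaAux, smul_eq_mul, e1, e2, e3, rpow_one]
  have e4 : (v * t ^ 2) ^ (s - 1) = v ^ (s - 1) * (t ^ (2 * s) / t ^ 2) := by
    rw [mul_rpow hv.le (by positivity), ← e1, ← rpow_mul ht.le, ← rpow_sub ht]
    ring_nf
  have e5 : v ^ (s - 1) * v ^ (1 - s) = 1 := by
    rw [← rpow_add hv]; simp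
  have e6 : rexp (-(π * v * t ^ 2 * A) - π * (v / t ^ 2) * B) =
      rexp (-(π * A) * (v * t ^ 2)) * rexp (-(π * B / (v * t ^ 2)) * v ^ 2) := by
    rw [← Real.exp_add]; congr 1; field_simp; ring
  rw [e4, e6]
  generalize rexp (-(π * A) * (v * t ^ 2)) = X
  generalize rexp (-(π * B / (v * t ^ 2)) * v ^ 2) = Y
  calc _ = X * Y * v * t ^ (2 * s) / t := by field_simp
    _ = X * Y * v * t ^ (2 * s) / t * (v ^ (s - 1) * v ^ (1 - s)) := by rw [e5, mul_one]
    _ = _ := by field_simp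

lemma thetaAux_outer (A B s x : ℝ) (hB : 0 < B) (hs₂ : s < 2) (hx : 0 < x) :
    ∫ v in Set.Ioi (0 : ℝ), thetaAux A B s x v =
      (1 / 4 * (π * B) ^ (-1 + s / 2) * Gamma (1 - s / 2)) *
        (x ^ (s / 2) * rexp (-(π * A) * x ^ (1:ℝ))) := by
  have hb : 0 < π * B / x := by positivity
  simp only [thetaAux]
  rw [integral_const_mul, integral_rpow_mul_exp_neg_mul_rpow two_pos (by linarith) hb]
  rw [show -(1 - s + 1) / 2 = -1 + s / 2 by ring, show (1 - s + 1) / 2 = 1 - s / 2 by ring]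
  rw [div_rpow (by positivity) hx.le]
  have e : x ^ (s - 1) = x ^ (s / 2) * x ^ (-1 + s / 2) := by
    rw [← rpow_add hx]; ring_nf
  have : 0 < x ^ (-1 + s / 2) := by positivity
  rw [e]
  field_simp
  norm_num
  ring

lemma thetaAux_integrable (A B s : ℝ) (hA : 0 < A) (hB : 0 < B)
    (hs₁ : -2 < s) (hs₂ : s < 2) :
    Integrable (Function.uncurry (thetaAux A B s))
      ((volume.restrict (Set.Ioi (0:ℝ))).prod (volume.restrict (Set.Ioi (0:ℝ)))) := by
  have hm : Measurable (Function.uncurry (thetaAux A B s)) := by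
    unfold thetaAux Function.uncurry
    fun_prop
  rw [integrable_prod_iff hm.aestronglyMeasurable]
  constructor
  · filter_upwards [ae_restrict_mem measurableSet_Ioi] with x hx
    have hx : 0 < x := hx
    have hb : 0 < π * B / x := by positivity
    simp only [Function.uncurry, thetaAux]
    exact (integrableOn_rpow_mul_exp_neg_mul_rpow (s := 1 - s) (by linarith) two_pos
      hb).const_mul _
  · have : IntegrableOn (fun x : ℝ => (1 / 4 * (π * B) ^ (-1 + s / 2) * Gamma (1 - s / 2)) *
        (x ^ (s / 2) * rexp (-(π * A) * x ^ (1:ℝ)))) (Set.Ioi 0) :=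
      (integrableOn_rpow_mul_exp_neg_mul_rpow (by linarith) (by norm_num)
      (by positivity)).const_mul _
    refine this.congr ?_
    filter_upwards [ae_restrict_mem measurableSet_Ioi] with x hx
    have hx : 0 < x := hx
    rw [← thetaAux_outer A B s x hB hs₂ hx]
    refine setIntegral_congr_fun measurableSet_Ioi fun v hv => ?_
    have hv : 0 < v := hv
    simp only [Function.uncurry, thetaAux]
    rw [Real.norm_of_nonneg (by positivity)]

/-- The unfolded theta integral: for `A, B > 0` and `−2 < s < 2`,
`∫₀^∞∫₀^∞ e^{−πvt²A − π(v/t²)B} v² t^{2s} (dv/v)(dt/t)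
  = (1/4) Γ(1 + s/2) Γ(1 − s/2) π⁻² A^{−1−s/2} B^{−1+s/2}`. -/
theorem theta_double_integral (A B s : ℝ) (hA : 0 < A) (hB : 0 < B)
    (hs₁ : -2 < s) (hs₂ : s < 2) :
    (∫ v in Set.Ioi (0 : ℝ), ∫ t in Set.Ioi (0 : ℝ),
        Real.exp (-(π * v * t ^ 2 * A) - π * (v / t ^ 2) * B) * v ^ 2 * t ^ (2 * s)
          * (1 / v) * (1 / t))
      = (1 / 4) * Real.Gamma (1 + s / 2) * Real.Gamma (1 - s / 2) / π ^ 2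
        * A ^ (-1 - s / 2) * B ^ (-1 + s / 2) := by
  rw [setIntegral_congr_fun measurableSet_Ioi fun v hv => thetaAux_inner A B s v hv]
  rw [← integral_integral_swap (thetaAux_integrable A B s hA hB hs₁ hs₂)]
  rw [setIntegral_congr_fun measurableSet_Ioi fun x hx => thetaAux_outer A B s x hB hs₂ hx]
  rw [integral_const_mul, integral_rpow_mul_exp_neg_mul_rpow one_pos (by linarith) (by positivity)]
  rw [show -(s / 2 + 1) / 1 = -1 - s / 2 by ring, show (s / 2 + 1) / 1 = 1 + s / 2 by ring]
  rw [mul_rpow pi_pos.le hA.le, mul_rpow pi_pos.le hB.le]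
  have e : π ^ (-1 + s / 2) * π ^ (-1 - s / 2) = 1 / π ^ 2 := by
    rw [← rpow_add pi_pos, show -1 + s / 2 + (-1 - s / 2) = -(2:ℕ) by push_cast; ring,
      rpow_neg pi_pos.le, rpow_natCast, one_div]
  calc _ = 1 / 4 * Gamma (1 + s / 2) * Gamma (1 - s / 2) * (π ^ (-1 + s / 2) * π ^ (-1 - s / 2))
        * A ^ (-1 - s / 2) * B ^ (-1 + s / 2) := by ring
    _ = _ := by rw [e]; ring
end
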